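/- arXiv:1307.8032 — 6 statements merged into one kernel-verified Lean document; each statement's English description precedes it below -/
import Mathlib

section
/- Let τ > 0 and let A, B ⊆ ℂ be τ-fat sets with A ∩ B ≠ ∅. Then A ∪ B is (τ/4)-fat. -/
open MeasureTheory

/-- A Lebesgue-measurable set `A ⊆ ℂ` is `τ`-fat if for every `x ∈ A` and every `r > 0`
such that the open disk `D(x,r)` does not contain `A`, one has
`area(A ∩ D(x,r)) ≥ τ · area(D(x,r))`. -/
def IsFat (τ : ℝ) (A : Set ℂ) : Prop :=
  ∀ x ∈ A, ∀ r : ℝ, 0 < r → ¬ A ⊆ Metric.ball x r →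
    ENNReal.ofReal τ * volume (Metric.ball x r) ≤ volume (A ∩ Metric.ball x r)

open Metric in
lemma quarter_ball {τ : ℝ} (x y : ℂ) {r : ℝ} (hr : 0 < r) :
    ENNReal.ofReal (τ / 4) * volume (ball x r) = ENNReal.ofReal τ * volume (ball y (r / 2)) := by
  rw [Complex.volume_ball, Complex.volume_ball, ← mul_assoc, ← mul_assoc,
    ← ENNReal.ofReal_pow hr.le, ← ENNReal.ofReal_pow (by positivity),
    ← ENNReal.ofReal_mul' (by positivity), ← ENNReal.ofReal_mul' (by positivity)]
  congr 2
  ring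

open Metric in
lemma fat_aux {τ : ℝ} (hτ : 0 < τ) {A B : Set ℂ}
    (hAfat : IsFat τ A) (hBfat : IsFat τ B) (hAB : (A ∩ B).Nonempty)
    (x : ℂ) (hx : x ∈ A) (r : ℝ) (hr : 0 < r) (hn : ¬ A ∪ B ⊆ ball x r) :
    ENNReal.ofReal (τ / 4) * volume (ball x r) ≤ volume ((A ∪ B) ∩ ball x r) := by
  by_cases hA : A ⊆ ball x r
  · obtain ⟨y, hyA, hyB⟩ := hAB
    have hB : ¬ B ⊆ ball x r := fun h => hn (Set.union_subset hA h)
    by_cases hy : y ∈ ball x (r / 2)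
    · have hsub : ball y (r / 2) ⊆ ball x r := by
        apply ball_subset_ball'
        have := mem_ball.1 hy
        linarith
      rw [quarter_ball x y hr]
      refine (hBfat y hyB (r / 2) (by positivity) fun h => hB (h.trans hsub)).trans ?_
      exact measure_mono (Set.inter_subset_inter Set.subset_union_right hsub)
    · rw [quarter_ball x x hr]
      refine (hAfat x hx (r / 2) (by positivity) fun h => hy (h hyA)).trans ?_
      exact measure_mono (Set.inter_subset_inter Set.subset_union_left
        (ball_subset_ball (by linarith)))
  · refine le_trans ?_ ((hAfat x hx r hr hA).trans
      (measure_mono (Set.inter_subset_inter_left _ Set.subset_union_left)))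
    gcongr
    linarith

/-- If `A` and `B` are `τ`-fat sets and `A ∩ B ≠ ∅`, then `A ∪ B` is `τ/4`-fat. -/
theorem isFat_union_of_isFat {τ : ℝ} (hτ : 0 < τ) {A B : Set ℂ}
    (hA : MeasurableSet A) (hB : MeasurableSet B)
    (hAfat : IsFat τ A) (hBfat : IsFat τ B) (hAB : (A ∩ B).Nonempty) :
    IsFat (τ / 4) (A ∪ B) := by
  intro x hx r hr hn
  rcases hx with hx | hx
  · exact fat_aux hτ hAfat hBfat hAB x hx r hr hn
  · rw [Set.union_comm] at hn ⊢
    rw [Set.inter_comm] at hAB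
    exact fat_aux hτ hBfat hAfat hAB x hx r hr hn
end

section
/- Every open Euclidean disk D(x₀,R) = {z ∈ ℂ : |z−x₀| < R} (x₀ ∈ ℂ, R > 0) is (1/4)-fat; that is, for every x ∈ D(x₀,R) and every r > 0 such that D(x,r) does not contain D(x₀,R), one has area(D(x₀,R) ∩ D(x,r)) ≥ (1/4)·area(D(x,r)). -/
open MeasureTheory

/-- Every open Euclidean disk `D(x₀, R)` is `1/4`-fat. -/
theorem isFat_ball (x₀ : ℂ) (R : ℝ) (hR : 0 < R) :
    IsFat (1 / 4) (Metric.ball x₀ R) := by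
  intro x hx r hr hsub
  have hd : dist x x₀ < R := hx
  have hrR : r ≤ R + dist x x₀ := by
    by_contra hcon
    apply hsub
    apply Metric.ball_subset_ball'
    rw [dist_comm x₀ x]
    linarith
  obtain ⟨u, hu, hxu⟩ : ∃ u : ℂ, ‖u‖ = 1 ∧ x₀ = x + ((dist x x₀ : ℝ) : ℂ) * u := by
    by_cases h : x = x₀
    · exact ⟨1, by simp, by simp [h]⟩
    · have h0 : dist x x₀ ≠ 0 := dist_ne_zero.mpr h
      have h1 : ((dist x x₀ : ℝ) : ℂ) ≠ 0 := by exact_mod_cast h0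
      refine ⟨(x₀ - x) / ((dist x x₀ : ℝ) : ℂ), ?_, ?_⟩
      · rw [norm_div, Complex.norm_real, ← dist_eq_norm, dist_comm x₀ x, Real.norm_eq_abs,
          abs_of_nonneg dist_nonneg, div_self h0]
      · rw [mul_div_cancel₀ _ h1]
        ring
  generalize dist x x₀ = d at *
  set c : ℂ := x + ((r / 2 : ℝ) : ℂ) * u with hc
  have hcx : dist c x = r / 2 := by
    rw [dist_eq_norm, hc, add_sub_cancel_left, norm_mul, hu, Complex.norm_real, mul_one,
      Real.norm_eq_abs, abs_of_pos (by linarith)]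
  have hcx0 : dist c x₀ = |r / 2 - d| := by
    have : c - x₀ = ((r / 2 - d : ℝ) : ℂ) * u := by
      rw [hc, hxu]
      push_cast
      ring
    rw [dist_eq_norm, this, norm_mul, hu, Complex.norm_real, mul_one, Real.norm_eq_abs]
  have hincl : Metric.ball c (r / 2) ⊆ Metric.ball x₀ R ∩ Metric.ball x r := by
    apply Set.subset_inter
    · apply Metric.ball_subset_ball'
      rw [hcx0]
      have : |r / 2 - d| ≤ R - r / 2 := abs_le.mpr ⟨by linarith, by linarith⟩
      linarith
    · apply Metric.ball_subset_ball'
      rw [hcx]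
      linarith
  refine le_trans (le_of_eq ?_) (measure_mono hincl)
  rw [Complex.volume_ball, Complex.volume_ball, ← mul_assoc, ← ENNReal.ofReal_pow hr.le,
    ← ENNReal.ofReal_pow (by linarith), ← ENNReal.ofReal_mul (by norm_num)]
  congr 2
  ring
end

section
/- Let G = (V,E) be a countable connected infinite graph, let M ≥ 1 be an integer, and let G' be a subdivision of G in which each edge e = [u,v] of G is replaced by a finite path in G' from u to v containing at most M vertices, where the interior vertices of the replacing paths are new vertices (not in V) and the interior vertex sets of the paths replacing distinct edges of G are pairwise disjoint. If G' is VEL-parabolic, then G is VEL-parabolic. -/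
/-- A graph `G = (V, E)` is VEL-parabolic if there is a function `m : V → [0, ∞)` with
`∑_{v ∈ V} m(v)² < ∞` and `∑_{v ∈ V(γ)} m(v) = ∞` for every transient path `γ` in `G`
(an infinite path visiting infinitely many distinct vertices). -/
def VELParabolic {V : Type*} (G : SimpleGraph V) : Prop :=
  ∃ m : V → ℝ, (∀ v, 0 ≤ m v) ∧ Summable (fun v => m v ^ 2) ∧
    ∀ γ : ℕ → V, (∀ n, G.Adj (γ n) (γ (n + 1))) → (Set.range γ).Infinite →
      ¬ Summable (fun v : Set.range γ => m v.1)



/-- Infinite concatenation of nontrivial connections. -/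
theorem exists_infinite_path_of_reachable {W : Type*} (H : SimpleGraph W) (x : ℕ → W)
    (hne : ∀ n, x n ≠ x (n + 1)) (hr : ∀ n, H.Reachable (x n) (x (n + 1))) :
    ∃ δ : ℕ → W, (∀ n, H.Adj (δ n) (δ (n + 1))) ∧ ∀ n, x n ∈ Set.range δ := by
  let p : ∀ n, H.Walk (x n) (x (n + 1)) := fun n => (hr n).some
  let Q : ∀ n, H.Walk (x 0) (x n) := fun n =>
    Nat.rec (motive := fun n => H.Walk (x 0) (x n)) SimpleGraph.Walk.nil
      (fun n q => q.append (p n)) n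
  have hQ : ∀ n, Q (n + 1) = (Q n).append (p n) := fun n => rfl
  have hp : ∀ n, 1 ≤ (p n).length := by
    intro n
    by_contra hcon
    have : (p n).length = 0 := by omega
    exact hne n (SimpleGraph.Walk.eq_of_length_eq_zero this)
  have hl : ∀ n, n ≤ (Q n).length := by
    intro n
    induction n with
    | zero => simp
    | succ n ih =>
      rw [hQ, SimpleGraph.Walk.length_append]
      have := hp n
      omega
  have hstep : ∀ n i, i ≤ (Q n).length → (Q (n + 1)).getVert i = (Q n).getVert i := by
    intro n i hi
    rw [hQ, SimpleGraph.Walk.getVert_append]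
    split_ifs with h
    · rfl
    · have : i = (Q n).length := by omega
      subst this
      simp
  have hlmono : ∀ n, (Q n).length ≤ (Q (n + 1)).length := by
    intro n
    rw [hQ, SimpleGraph.Walk.length_append]
    omega
  have hst : ∀ n k i, i ≤ (Q n).length →
      i ≤ (Q (n + k)).length ∧ (Q (n + k)).getVert i = (Q n).getVert i := by
    intro n k i hi
    induction k with
    | zero => exact ⟨hi, rfl⟩
    | succ k ih =>
      exact ⟨ih.1.trans (hlmono _), (hstep (n + k) i ih.1).trans ih.2⟩
  refine ⟨fun i => (Q i).getVert i, ?_, ?_⟩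
  · intro n
    have h1 := (hst n 1 n (hl n)).2
    show H.Adj ((Q n).getVert n) ((Q (n + 1)).getVert (n + 1))
    rw [← h1]
    exact SimpleGraph.Walk.adj_getVert_succ _ (hl (n + 1))
  · intro n
    refine ⟨(Q n).length, ?_⟩
    obtain ⟨k, hk⟩ := Nat.exists_eq_add_of_le (hl n)
    have := (hst n k (Q n).length le_rfl).2
    rw [← hk] at this
    show (Q (Q n).length).getVert (Q n).length = x n
    rw [this]
    simp

/-- Sums over fibers of a summable function are summable. -/
theorem summable_fiber_sums {V V' : Type*} (f : V' → ℝ) (hf : Summable f) (a : V' → V) :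
    Summable (fun v => ∑' w : {w // a w = v}, f w.1) := by
  have h : Summable (fun x : (Σ v, {w // a w = v}) => f x.2.1) :=
    (Equiv.summable_iff (Equiv.sigmaFiberEquiv a) (f := f)).2 hf
  exact h.sigma

theorem le_fiber_sum {V V' : Type*} (f : V' → ℝ) (h0 : ∀ w, 0 ≤ f w) (hf : Summable f)
    (a : V' → V) (w : V') : f w ≤ ∑' z : {z // a z = a w}, f z.1 := by
  have h : Summable (fun z : {z // a z = a w} => f z.1) := hf.subtype _
  exact h.le_tsum ⟨w, rfl⟩ (fun z _ => h0 z.1)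

/-- Let `G` be a countable connected infinite graph and let `G'` be a subdivision of `G`
in which each edge `[u, v]` of `G` is replaced by a finite path in `G'` from `u` to `v`
containing at most `M` vertices, where the interior vertices of the replacing paths are new
vertices and the interiors of the paths replacing distinct edges are pairwise disjoint.
If `G'` is VEL-parabolic, then `G` is VEL-parabolic. -/
theorem velParabolic_of_subdivision {V V' : Type*} [Countable V] [Countable V'] [Infinite V]
    (G : SimpleGraph V) (hGconn : G.Connected)
    (M : ℕ) (hM : 1 ≤ M)
    (G' : SimpleGraph V') (ι : V → V') (hι : Function.Injective ι)
    -- each edge `[u,v]` of `G` is replaced by a path `P u v h` in `G'` from `ι u` to `ι v`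
    (P : ∀ (u v : V), G.Adj u v → G'.Walk (ι u) (ι v))
    (hpath : ∀ (u v : V) (h : G.Adj u v), (P u v h).IsPath)
    -- the replacing path contains at most `M` vertices
    (hlen : ∀ (u v : V) (h : G.Adj u v), (P u v h).support.length ≤ M)
    -- the replacing path depends only on the (unordered) edge
    (hrev : ∀ (u v : V) (h : G.Adj u v), (P u v h).reverse = P v u h.symm)
    -- the interior vertices of the replacing paths are new vertices, not in `V`
    (hnew : ∀ (u v : V) (h : G.Adj u v), ∀ w ∈ (P u v h).support,
      w = ι u ∨ w = ι v ∨ w ∉ Set.range ι)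
    -- the interiors of the paths replacing distinct edges are pairwise disjoint
    (hdisj : ∀ (u v u' v' : V) (h : G.Adj u v) (h' : G.Adj u' v'),
      s(u, v) ≠ s(u', v') → ∀ w : V',
        w ∈ (P u v h).support → w ∈ (P u' v' h').support → w ∈ Set.range ι)
    -- every vertex of `G'` is a vertex of `G` or lies on a replacing path
    (hcovV : ∀ w : V', w ∈ Set.range ι ∨ ∃ (u v : V) (h : G.Adj u v), w ∈ (P u v h).support)
    -- every edge of `G'` lies on a replacing path
    (hcovE : ∀ a b : V', G'.Adj a b → ∃ (u v : V) (h : G.Adj u v),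
      s(a, b) ∈ (P u v h).edges) :
    VELParabolic G' → VELParabolic G := by
  classical
  rintro ⟨m', h0, hsq, htr⟩
  haveI : Nonempty V := inferInstance
  have hab : ∀ w : V', ∃ ab : V × V, ∀ (u v : V) (h : G.Adj u v), w ∈ (P u v h).support →
      w ∉ Set.range ι → s(u, v) = s(ab.1, ab.2) := by
    intro w
    by_cases hw : ∃ (u v : V) (h : G.Adj u v), w ∈ (P u v h).support
    · obtain ⟨u, v, h, hm⟩ := hw
      refine ⟨(u, v), fun u' v' h' hm' hn => ?_⟩
      by_contra hcon
      exact hn (hdisj u' v' u v h' h hcon w hm' hm)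
    · exact ⟨(Classical.arbitrary V, Classical.arbitrary V),
        fun u v h hm _ => (hw ⟨u, v, h, hm⟩).elim⟩
  choose ab hab using hab
  have hf0 : ∀ w, 0 ≤ m' w ^ 2 := fun w => sq_nonneg _
  let A : V → ℝ := fun v => ∑' w : {w // (ab w).1 = v}, m' w.1 ^ 2
  let B : V → ℝ := fun v => ∑' w : {w // (ab w).2 = v}, m' w.1 ^ 2
  have hA : Summable A := summable_fiber_sums (fun w => m' w ^ 2) hsq (fun w => (ab w).1)
  have hB : Summable B := summable_fiber_sums (fun w => m' w ^ 2) hsq (fun w => (ab w).2)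
  have hA0 : ∀ v, 0 ≤ A v := fun v => tsum_nonneg fun w => hf0 _
  have hB0 : ∀ v, 0 ≤ B v := fun v => tsum_nonneg fun w => hf0 _
  have hAle : ∀ w, m' w ^ 2 ≤ A (ab w).1 :=
    le_fiber_sum (fun w => m' w ^ 2) hf0 hsq (fun w => (ab w).1)
  have hBle : ∀ w, m' w ^ 2 ≤ B (ab w).2 :=
    le_fiber_sum (fun w => m' w ^ 2) hf0 hsq (fun w => (ab w).2)
  let m : V → ℝ := fun v => Real.sqrt (m' (ι v) ^ 2 + A v + B v)
  have hm_ι : ∀ v, m' (ι v) ≤ m v := by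
    intro v
    apply Real.le_sqrt_of_sq_le
    linarith [hA0 v, hB0 v]
  have hm_int : ∀ (u v : V) (h : G.Adj u v) (w : V'), w ∈ (P u v h).support →
      w ∉ Set.range ι → m' w ≤ m v := by
    intro u v h w hw hn
    apply Real.le_sqrt_of_sq_le
    have := hab w u v h hw hn
    rw [Sym2.eq_iff] at this
    rcases this with ⟨_, h2⟩ | ⟨_, h2⟩
    · have h3 := hBle w
      rw [← h2] at h3
      linarith [hA0 v, hf0 (ι v)]
    · have h3 := hAle w
      rw [← h2] at h3
      linarith [hB0 v, hf0 (ι v)]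
  refine ⟨m, fun v => Real.sqrt_nonneg _, ?_, ?_⟩
  · have : (fun v => m v ^ 2) = fun v => m' (ι v) ^ 2 + A v + B v := by
      funext v
      exact Real.sq_sqrt (by linarith [hA0 v, hB0 v, hf0 (ι v)])
    rw [this]
    exact ((hsq.comp_injective hι).add hA).add hB
  intro γ hγ hinf hsum
  -- the tree of first visits
  let S : Set V' := {w | w = ι (γ 0) ∨ ∃ n, (∀ k ≤ n, γ k ≠ γ (n + 1)) ∧
    w ∈ (P (γ n) (γ (n + 1)) (hγ n)).support}
  have hreach : ∀ n, ∃ h : ι (γ n) ∈ S, ∃ h0 : ι (γ 0) ∈ S,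
      (G'.induce S).Reachable ⟨ι (γ 0), h0⟩ ⟨ι (γ n), h⟩ := by
    intro n
    induction n using Nat.strong_induction_on with
    | _ n ih =>
      rcases n with _ | n
      · exact ⟨Or.inl rfl, Or.inl rfl, SimpleGraph.Reachable.refl _⟩
      · by_cases hv : ∃ k ≤ n, γ k = γ (n + 1)
        · obtain ⟨k, hk, he⟩ := hv
          have := ih k (by omega)
          rwa [he] at this
        · push Not at hv
          obtain ⟨h1, h2, h3⟩ := ih n (by omega)
          have hsub : ∀ w ∈ (P (γ n) (γ (n + 1)) (hγ n)).support, w ∈ S :=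
            fun w hw => Or.inr ⟨n, hv, hw⟩
          refine ⟨hsub _ (SimpleGraph.Walk.end_mem_support _), h2, h3.trans ?_⟩
          exact ⟨(P (γ n) (γ (n + 1)) (hγ n)).induce S hsub⟩
  choose hS hS0 hR using hreach
  obtain ⟨δ, hδ, hδx⟩ := exists_infinite_path_of_reachable (G'.induce S)
    (fun n => ⟨ι (γ n), hS n⟩)
    (fun n he => (hγ n).ne (hι (Subtype.mk.inj he)))
    (fun n => (hR n).symm.trans (hR (n + 1)))
  have hsub : Set.range (fun n => (δ n).1) ⊆ S := by
    rintro _ ⟨n, rfl⟩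
    exact (δ n).2
  refine htr (fun n => (δ n).1) (fun n => hδ n) ?_ ?_
  · refine (hinf.image (f := ι) hι.injOn).mono ?_
    rintro _ ⟨_, ⟨n, rfl⟩, rfl⟩
    obtain ⟨i, hi⟩ := hδx n
    exact ⟨i, by simp [hi]⟩
  -- summability over `S`
  suffices hSS : Summable (fun w : S => m' w.1) from
    hSS.comp_injective (i := Set.inclusion hsub) (Set.inclusion_injective hsub)
  let F : Set.range γ → ℕ := fun v => Nat.find v.2
  have hF : ∀ n (hn : ∀ k ≤ n, γ k ≠ γ (n + 1)), F ⟨γ (n + 1), n + 1, rfl⟩ = n + 1 := by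
    intro n hn
    refine (Nat.find_eq_iff _).2 ⟨rfl, fun k hk => hn k (by omega)⟩
  let g : ℕ → ℕ → V' := fun j i => Nat.casesOn j (ι (γ 0))
    (fun k => (P (γ k) (γ (k + 1)) (hγ k)).getVert i)
  let φ : Set.range γ × Fin (M + 1) → V' := fun x =>
    if x.2.1 = M then ι x.1.1 else g (F x.1) x.2.1
  have hφ : ∀ w : S, ∃ x, φ x = w.1 ∧ m' w.1 ≤ m x.1.1 := by
    have key : ∀ k, ∃ x, φ x = ι (γ k) ∧ m' (ι (γ k)) ≤ m x.1.1 := fun k =>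
      ⟨(⟨γ k, k, rfl⟩, ⟨M, by omega⟩), by simp [φ], hm_ι _⟩
    rintro ⟨w, rfl | ⟨n, hn, hw⟩⟩
    · exact key 0
    · rcases hnew _ _ _ w hw with rfl | rfl | hnr
      · exact key n
      · exact key (n + 1)
      · obtain ⟨i, hi, hil⟩ := SimpleGraph.Walk.mem_support_iff_exists_getVert.1 hw
        have hlen' := hlen _ _ (hγ n)
        rw [SimpleGraph.Walk.length_support] at hlen'
        refine ⟨(⟨γ (n + 1), n + 1, rfl⟩, ⟨i, by omega⟩), ?_, hm_int _ _ _ w hw hnr⟩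
        have hiM : i ≠ M := by omega
        simp only [φ, hiM, if_false, hF n hn]
        exact hi
  choose ψ hψ hψm using hφ
  have hinj : Function.Injective ψ := by
    intro w z h
    apply Subtype.ext
    rw [← hψ w, ← hψ z, h]
  have hprod : Summable (fun x : Set.range γ × Fin (M + 1) => m x.1.1) := by
    have := hsum.mul_of_nonneg (g := fun _ : Fin (M + 1) => (1 : ℝ)) (Summable.of_finite)
      (fun v => Real.sqrt_nonneg _) (fun _ => zero_le_one)
    simpa using this
  exact Summable.of_nonneg_of_le (fun w => h0 _) hψm (hprod.comp_injective hinj)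
end

section
/- Let V and V' be countable sets, let N ≥ 1 be an integer, let S : V → Finset(V') assign to each v ∈ V a nonempty finite subset S(v) ⊆ V', and suppose every w ∈ V' belongs to S(v) for at most N distinct v ∈ V. If m' : V' → [0,∞) satisfies ∑_{w∈V'} m'(w)² < ∞, then the function m : V → [0,∞) defined by m(v) = max{ m'(w) : w ∈ S(v) } satisfies ∑_{v∈V} m(v)² ≤ N·∑_{w∈V'} m'(w)² < ∞. -/
/-- The maximum of a square-summable nonnegative function over finite sets with overlap
bounded by `N` is square-summable, with `∑_{v} m(v)² ≤ N · ∑_{w} m'(w)²`. -/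
theorem summable_sq_max_of_bounded_overlap {V V' : Type*} [Countable V] [Countable V']
    (N : ℕ) (hN : 1 ≤ N)
    (S : V → Finset V') (hS : ∀ v, (S v).Nonempty)
    (hfin : ∀ w : V', ({v : V | w ∈ S v}).Finite)
    (hover : ∀ w : V', ({v : V | w ∈ S v}).ncard ≤ N)
    (m' : V' → ℝ) (hm' : ∀ w, 0 ≤ m' w)
    (hsum : Summable (fun w => m' w ^ 2)) :
    Summable (fun v => ((S v).sup' (hS v) m') ^ 2) ∧
      ∑' v, ((S v).sup' (hS v) m') ^ 2 ≤ N * ∑' w, m' w ^ 2 := by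
  classical
  have hex : ∀ v, ∃ w, w ∈ S v ∧ (S v).sup' (hS v) m' = m' w := fun v =>
    Finset.exists_mem_eq_sup' (hS v) m'
  choose f hfS hfm using hex
  have key : ∀ A : Finset V,
      ∑ v ∈ A, ((S v).sup' (hS v) m') ^ 2 ≤ N * ∑' w, m' w ^ 2 := by
    intro A
    calc ∑ v ∈ A, ((S v).sup' (hS v) m') ^ 2 = ∑ v ∈ A, m' (f v) ^ 2 :=
          Finset.sum_congr rfl (fun v _ => by rw [hfm v])
      _ = ∑ w ∈ A.image f, (A.filter (fun v => f v = w)).card • m' w ^ 2 :=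
          Finset.sum_comp (fun w => m' w ^ 2) f
      _ ≤ ∑ w ∈ A.image f, (N : ℝ) * m' w ^ 2 := by
          refine Finset.sum_le_sum fun w _ => ?_
          rw [nsmul_eq_mul]
          refine mul_le_mul_of_nonneg_right ?_ (sq_nonneg _)
          have h : (A.filter (fun v => f v = w)).card ≤ N := by
            refine le_trans ?_ (hover w)
            rw [← Set.ncard_coe_finset]
            refine Set.ncard_le_ncard ?_ (hfin w)
            intro v hv
            have hv2 : f v = w := (Finset.mem_filter.mp (Finset.mem_coe.mp hv)).2
            exact hv2 ▸ hfS v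
          exact_mod_cast h
      _ = N * ∑ w ∈ A.image f, m' w ^ 2 := by rw [Finset.mul_sum]
      _ ≤ N * ∑' w, m' w ^ 2 :=
          mul_le_mul_of_nonneg_left
            (hsum.sum_le_tsum _ (fun w _ => sq_nonneg _)) (Nat.cast_nonneg N)
  have hs : Summable (fun v => ((S v).sup' (hS v) m') ^ 2) :=
    summable_of_sum_le (fun v => sq_nonneg _) key
  exact ⟨hs, hs.tsum_le_of_sum_le key⟩
end

section
/- Let A, B, C ∈ ℂ be affinely independent points and let a, b, c > 0 satisfy |A−B| = a + b, |B−C| = b + c, and |A−C| = a + c (so that the circles centered at A, B, C with radii a, b, c are mutually externally tangent). Let T_AB = A + (a/(a+b))(B−A), T_BC = B + (b/(b+c))(C−B), and T_AC = A + (a/(a+c))(C−A) be the three pairwise tangency points. Then there exist a point I ∈ ℂ and a radius r > 0 such that |I−T_AB| = |I−T_BC| = |I−T_AC| = r and r equals the distance from I to each of the three lines through A and B, through B and C, and through A and C; in other words, the inscribed circle of the triangle ABC passes through the three tangency points. -/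
theorem dist_sq_coords (P Q : ℂ) : dist P Q ^ 2 = (P.re - Q.re) ^ 2 + (P.im - Q.im) ^ 2 := by
  rw [Complex.dist_eq, ← Complex.normSq_eq_norm_sq, Complex.normSq_apply]
  simp only [Complex.sub_re, Complex.sub_im]
  ring

theorem tangency_aux (P Q I : ℂ) (p q r : ℝ) (hp : 0 < p) (hq : 0 < q) (hr : 0 < r)
    (hPQ : dist P Q = p + q) (hIP : dist I P ^ 2 = r ^ 2 + p ^ 2)
    (hIQ : dist I Q ^ 2 = r ^ 2 + q ^ 2) :
    dist I (P + (p / (p + q)) • (Q - P)) = r ∧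
      Metric.infDist I (affineSpan ℝ ({P, Q} : Set ℂ) : Set ℂ) = r := by
  have key : ∀ t : ℝ, dist I (P + t • (Q - P)) ^ 2 = r ^ 2 + (p - t * (p + q)) ^ 2 := by
    intro t
    have h3 : dist P Q ^ 2 = (p + q) ^ 2 := by rw [hPQ]
    rw [dist_sq_coords] at hIP hIQ h3 ⊢
    simp only [Complex.add_re, Complex.add_im, Complex.real_smul, Complex.mul_re, Complex.mul_im,
      Complex.ofReal_re, Complex.ofReal_im, Complex.sub_re, Complex.sub_im]
    linear_combination (1 - t) * hIP + t * hIQ - t * (1 - t) * h3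
  have hT : dist I (P + (p / (p + q)) • (Q - P)) = r := by
    have h := key (p / (p + q))
    rw [div_mul_cancel₀ _ (by positivity)] at h
    have h2 : dist I (P + (p / (p + q)) • (Q - P)) ^ 2 = r ^ 2 := by rw [h]; ring
    exact (pow_left_inj₀ dist_nonneg hr.le two_ne_zero).1 h2
  have hmem : ∀ t : ℝ, AffineMap.lineMap P Q t = P + t • (Q - P) := by
    intro t
    rw [AffineMap.lineMap_apply]
    simp [add_comm]
  refine ⟨hT, le_antisymm ?_ ?_⟩
  · rw [← hT]
    apply Metric.infDist_le_dist_of_mem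
    rw [← hmem]
    exact AffineMap.lineMap_mem_affineSpan_pair _ _ _
  · refine (Metric.le_infDist ⟨P, left_mem_affineSpan_pair ℝ P Q⟩).2 ?_
    intro X hX
    obtain ⟨t, rfl⟩ := mem_affineSpan_pair_iff_exists_lineMap_eq.1 hX
    rw [hmem]
    refine (pow_le_pow_iff_left₀ hr.le dist_nonneg two_ne_zero).1 ?_
    rw [key]
    nlinarith [sq_nonneg (p - t * (p + q))]


/-- For three mutually externally tangent circles with affinely independent centers
`A, B, C` and radii `a, b, c`, the inscribed circle of the triangle `ABC` passes through
the three pairwise tangency points: there are `I ∈ ℂ` and `r > 0` with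
`|I − T_AB| = |I − T_BC| = |I − T_AC| = r`, where `r` is also the distance from `I` to
each of the three lines through pairs of the centers. -/
theorem incircle_through_tangency_points (A B C : ℂ)
    (hind : AffineIndependent ℝ ![A, B, C])
    (a b c : ℝ) (ha : 0 < a) (hb : 0 < b) (hc : 0 < c)
    (hAB : dist A B = a + b) (hBC : dist B C = b + c) (hAC : dist A C = a + c) :
    ∃ (I : ℂ) (r : ℝ), 0 < r ∧
      dist I (A + (a / (a + b)) • (B - A)) = r ∧
      dist I (B + (b / (b + c)) • (C - B)) = r ∧
      dist I (A + (a / (a + c)) • (C - A)) = r ∧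
      Metric.infDist I (affineSpan ℝ ({A, B} : Set ℂ) : Set ℂ) = r ∧
      Metric.infDist I (affineSpan ℝ ({B, C} : Set ℂ) : Set ℂ) = r ∧
      Metric.infDist I (affineSpan ℝ ({A, C} : Set ℂ) : Set ℂ) = r := by

  have hr : 0 < √(a * b * c / (a + b + c)) := by positivity
  have hr2 : √(a * b * c / (a + b + c)) ^ 2 = a * b * c / (a + b + c) :=
    Real.sq_sqrt (by positivity)
  have hs : a + b + c ≠ 0 := by positivity
  obtain ⟨I, hI⟩ : ∃ I : ℂ, I = ⟨((b + c) * A.re + (a + c) * B.re + (a + b) * C.re) /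
      (2 * (a + b + c)), ((b + c) * A.im + (a + c) * B.im + (a + b) * C.im) /
      (2 * (a + b + c))⟩ := ⟨_, rfl⟩
  have h1 : dist A B ^ 2 = (a + b) ^ 2 := by rw [hAB]
  have h2 : dist B C ^ 2 = (b + c) ^ 2 := by rw [hBC]
  have h3 : dist A C ^ 2 = (a + c) ^ 2 := by rw [hAC]
  rw [dist_sq_coords] at h1 h2 h3
  -- |I - X|² = Σ wᵢ |X - Pᵢ|² - Σ wᵢ wⱼ |Pᵢ - Pⱼ|²
  have gen : ∀ X : ℂ, dist I X ^ 2 =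
      ((b + c) * dist A X ^ 2 + (a + c) * dist B X ^ 2 + (a + b) * dist C X ^ 2) /
        (2 * (a + b + c)) -
      ((b + c) * (a + c) * (a + b) ^ 2 + (a + c) * (a + b) * (b + c) ^ 2 +
        (b + c) * (a + b) * (a + c) ^ 2) / (2 * (a + b + c)) ^ 2 := by
    intro X
    rw [← h1, ← h2, ← h3]
    simp only [dist_sq_coords, hI]
    field_simp
    ring
  have hIA : dist I A ^ 2 = √(a * b * c / (a + b + c)) ^ 2 + a ^ 2 := by
    rw [gen, hr2, dist_self, dist_comm B A, dist_comm C A, hAB, hAC]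
    field_simp
    ring
  have hIB : dist I B ^ 2 = √(a * b * c / (a + b + c)) ^ 2 + b ^ 2 := by
    rw [gen, hr2, dist_self, dist_comm C B, hAB, hBC]
    field_simp
    ring
  have hIC : dist I C ^ 2 = √(a * b * c / (a + b + c)) ^ 2 + c ^ 2 := by
    rw [gen, hr2, dist_self, hAC, hBC]
    field_simp
    ring
  obtain ⟨x1, y1⟩ := tangency_aux A B I a b _ ha hb hr hAB hIA hIB
  obtain ⟨x2, y2⟩ := tangency_aux B C I b c _ hb hc hr hBC hIB hIC
  obtain ⟨x3, y3⟩ := tangency_aux A C I a c _ ha hc hr hAC hIA hIC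
  exact ⟨I, _, hr, x1, x2, x3, y1, y2, y3⟩
end

section
/- Let G = (V,E) be a countable connected graph with infinitely many vertices, let τ > 0 and M ≥ 1, and let (P_v : v ∈ V) be a collection of τ-fat sets satisfying: (1) each P_v is a compact connected subset of ℂ; (2) the collection is locally finite in ℂ, i.e., for every compact K ⊆ ℂ there are only finitely many v ∈ V with P_v ∩ K ≠ ∅; (3) every x ∈ ℂ is contained in P_v for at most M vertices v ∈ V; (4) if v and w are adjacent in G then P_v ∩ P_w ≠ ∅. Then G is VEL-parabolic. -/
open MeasureTheory

/-- Length of the radial shadow of `A` in the annulus `R ≤ |z| ≤ 2R`. -/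
noncomputable def radLen (A : Set ℂ) (R : ℝ) : ℝ :=
  (volume ((fun z : ℂ => ‖z‖) '' A ∩ Set.Icc R (2 * R))).toReal

lemma radLen_nonneg (A : Set ℂ) (R : ℝ) : 0 ≤ radLen A R := ENNReal.toReal_nonneg

lemma radLen_vol_ne_top (A : Set ℂ) (R : ℝ) :
    volume ((fun z : ℂ => ‖z‖) '' A ∩ Set.Icc R (2 * R)) ≠ ⊤ := by
  refine ne_top_of_le_ne_top ?_ (measure_mono Set.inter_subset_right)
  simp

lemma radLen_le (A : Set ℂ) (R : ℝ) (hR : 0 < R) : radLen A R ≤ R := by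
  have h : volume ((fun z : ℂ => ‖z‖) '' A ∩ Set.Icc R (2 * R)) ≤ ENNReal.ofReal R := by
    refine (measure_mono Set.inter_subset_right).trans ?_
    rw [Real.volume_Icc]
    exact ENNReal.ofReal_le_ofReal (by linarith)
  exact ENNReal.toReal_le_of_le_ofReal hR.le h

lemma radLen_exists (A : Set ℂ) (R : ℝ) (h : radLen A R ≠ 0) :
    ∃ x ∈ A, R ≤ ‖x‖ ∧ ‖x‖ ≤ 2 * R := by
  by_contra hcon
  push Not at hcon
  apply h
  have : (fun z : ℂ => ‖z‖) '' A ∩ Set.Icc R (2 * R) = ∅ := by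
    ext t
    simp only [Set.mem_inter_iff, Set.mem_image, Set.mem_Icc, Set.mem_empty_iff_false, iff_false]
    rintro ⟨⟨x, hx, rfl⟩, h1, h2⟩
    exact absurd h2 (not_le.2 (hcon x hx h1))
  simp [radLen, this]

lemma radLen_sq_le (τ : ℝ) (hτ : 0 < τ) (A : Set ℂ) (hA : IsFat τ A) (R : ℝ) (hR : 0 < R) :
    radLen A R ^ 2 * (τ * Real.pi / 16) ≤ (volume (A ∩ Metric.ball 0 (3 * R))).toReal := by
  by_cases h0 : radLen A R = 0
  · rw [h0]; simp
  obtain ⟨x, hx, h1, h2⟩ := radLen_exists A R h0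
  have hpos : 0 < radLen A R := lt_of_le_of_ne (radLen_nonneg A R) (Ne.symm h0)
  have hle := radLen_le A R hR
  set r := radLen A R / 4 with hr
  have hr0 : 0 < r := by positivity
  have hns : ¬ A ⊆ Metric.ball x r := by
    intro hs
    have hsub : (fun z : ℂ => ‖z‖) '' A ∩ Set.Icc R (2 * R) ⊆ Metric.ball ‖x‖ r := by
      rintro t ⟨⟨y, hy, rfl⟩, -⟩
      have := hs hy
      rw [Metric.mem_ball, dist_eq_norm] at this ⊢
      exact lt_of_le_of_lt (abs_norm_sub_norm_le y x) this
    have hm := measure_mono (μ := volume) hsub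
    rw [Real.volume_ball] at hm
    have : radLen A R ≤ 2 * r := ENNReal.toReal_le_of_le_ofReal (by positivity) hm
    linarith
  have hf := hA x hx r hr0 hns
  have hsub : A ∩ Metric.ball x r ⊆ A ∩ Metric.ball 0 (3 * R) := by
    refine Set.inter_subset_inter_right _ (Metric.ball_subset_ball' ?_)
    rw [dist_zero_right]; linarith
  have hf2 := hf.trans (measure_mono hsub)
  have hfin : volume (A ∩ Metric.ball (0:ℂ) (3 * R)) ≠ ⊤ :=
    ne_top_of_le_ne_top measure_ball_lt_top.ne (measure_mono Set.inter_subset_right)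
  have := ENNReal.toReal_mono hfin hf2
  rw [Complex.volume_ball] at this
  simp only [ENNReal.toReal_mul, ENNReal.toReal_pow, ENNReal.toReal_ofReal hτ.le,
    ENNReal.toReal_ofReal hr0.le, ENNReal.coe_toReal, NNReal.coe_real_pi] at this
  calc _ = τ * (r ^ 2 * Real.pi) := by rw [hr]; ring
    _ ≤ _ := this

lemma sum_vol_le {V : Type*} (M : ℕ) (P : V → Set ℂ)
    (hmeas : ∀ v, MeasurableSet (P v))
    (hoverfin : ∀ x : ℂ, ({v : V | x ∈ P v}).Finite)
    (hover : ∀ x : ℂ, ({v : V | x ∈ P v}).ncard ≤ M) (B : Set ℂ)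
    (s : Finset V) :
    ∑ v ∈ s, volume (P v ∩ B) ≤ M * volume B := by
  classical
  have h1 : ∀ v, volume (P v ∩ B) = ∫⁻ x in B, (P v).indicator 1 x := by
    intro v
    rw [lintegral_indicator_one (hmeas v), Measure.restrict_apply (hmeas v)]
  simp_rw [h1]
  rw [← lintegral_finsetSum]
  · calc _ ≤ ∫⁻ x in B, (M : ENNReal) := by
          refine lintegral_mono fun x => ?_
          have : ∑ v ∈ s, (P v).indicator (1 : ℂ → ENNReal) x
              = ((s.filter (fun v => x ∈ P v)).card : ENNReal) := by
            rw [Finset.card_filter]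
            push_cast
            refine Finset.sum_congr rfl fun v _ => ?_
            by_cases h : x ∈ P v <;> simp [h]
          rw [this]
          have h2 : (s.filter (fun v => x ∈ P v)).card ≤ M := by
            rw [← Set.ncard_coe_finset]
            refine (Set.ncard_le_ncard ?_ (hoverfin x)).trans (hover x)
            intro v hv
            simpa using (Finset.mem_filter.1 (Finset.mem_coe.1 hv)).2
          exact Nat.cast_le.2 h2
      _ = _ := by rw [setLIntegral_const]
  · intro v _
    exact measurable_one.indicator (hmeas v)

lemma sum_radLen_sq_le {V : Type*} (τ : ℝ) (hτ : 0 < τ) (M : ℕ) (P : V → Set ℂ)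
    (hmeas : ∀ v, MeasurableSet (P v)) (hfat : ∀ v, IsFat τ (P v))
    (hoverfin : ∀ x : ℂ, ({v : V | x ∈ P v}).Finite)
    (hover : ∀ x : ℂ, ({v : V | x ∈ P v}).ncard ≤ M) (R : ℝ) (hR : 0 < R)
    (s : Finset V) :
    ∑ v ∈ s, (radLen (P v) R / R) ^ 2 ≤ 144 * M / τ := by
  have hfin : ∀ v, volume (P v ∩ Metric.ball (0:ℂ) (3 * R)) ≠ ⊤ := fun v =>
    ne_top_of_le_ne_top measure_ball_lt_top.ne (measure_mono Set.inter_subset_right)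
  have h1 : ∑ v ∈ s, radLen (P v) R ^ 2 * (τ * Real.pi / 16) ≤ M * ((3 * R) ^ 2 * Real.pi) := by
    calc _ ≤ ∑ v ∈ s, (volume (P v ∩ Metric.ball 0 (3 * R))).toReal :=
          Finset.sum_le_sum fun v _ => radLen_sq_le τ hτ _ (hfat v) R hR
      _ = (∑ v ∈ s, volume (P v ∩ Metric.ball 0 (3 * R))).toReal := by
          rw [ENNReal.toReal_sum fun v _ => hfin v]
      _ ≤ (M * volume (Metric.ball (0:ℂ) (3 * R))).toReal := by
          refine ENNReal.toReal_mono ?_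
            (sum_vol_le M P hmeas hoverfin hover _ s)
          exact ENNReal.mul_ne_top (by simp) measure_ball_lt_top.ne
      _ = _ := by
          rw [Complex.volume_ball]
          simp only [ENNReal.toReal_mul, ENNReal.toReal_pow, ENNReal.toReal_natCast,
            ENNReal.toReal_ofReal (by positivity : 0 ≤ 3 * R), ENNReal.coe_toReal,
            NNReal.coe_real_pi]
  rw [← Finset.sum_mul] at h1
  simp_rw [div_pow]
  rw [← Finset.sum_div, div_le_div_iff₀ (by positivity) hτ]
  have hpi := Real.pi_pos
  have h2 : Real.pi * ((∑ v ∈ s, radLen (P v) R ^ 2) * τ) ≤ Real.pi * (144 * M * R ^ 2) := by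
    linarith
  exact le_of_mul_le_mul_left h2 hpi

/-- Crossing estimate. -/
lemma crossing {V : Type*} [DecidableEq V] (P : V → Set ℂ) (hconn : ∀ v, IsConnected (P v))
    (γ : ℕ → V) (hγ : ∀ n, (P (γ n) ∩ P (γ (n + 1))).Nonempty) (R : ℝ) (hR : 0 < R)
    (h0 : P (γ 0) ⊆ Metric.ball 0 R) (n : ℕ)
    (hn : P (γ n) ∩ Metric.closedBall 0 (2 * R) = ∅) :
    1 ≤ ∑ v ∈ (Finset.range (n + 1)).image γ, radLen (P v) R / R := by
  have hun : IsPreconnected (⋃ i ∈ Set.Iic n, P (γ i)) := by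
    apply IsPreconnected.biUnion_of_chain
    · exact Set.ordConnected_Iic
    · intro i _; exact (hconn _).isPreconnected
    · intro i _ _; exact hγ i
  have him := hun.image (fun z : ℂ => ‖z‖) continuous_norm.continuousOn
  obtain ⟨a, ha⟩ := (hconn (γ 0)).nonempty
  obtain ⟨b, hb⟩ := (hconn (γ n)).nonempty
  have ha1 : ‖a‖ < R := by simpa using h0 ha
  have hb1 : 2 * R < ‖b‖ := by
    by_contra hcon
    have : b ∈ P (γ n) ∩ Metric.closedBall 0 (2 * R) := ⟨hb, by simpa using hcon⟩
    rw [hn] at this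
    exact this
  have hsub := him.Icc_subset (a := ‖a‖) (b := ‖b‖)
    ⟨a, Set.mem_biUnion (Set.mem_Iic.2 (Nat.zero_le n)) ha, rfl⟩
    ⟨b, Set.mem_biUnion (Set.mem_Iic.2 le_rfl) hb, rfl⟩
  have hcov : Set.Icc R (2 * R) ⊆ ⋃ v ∈ (Finset.range (n + 1)).image γ,
      ((fun z : ℂ => ‖z‖) '' P v ∩ Set.Icc R (2 * R)) := by
    intro t ht
    obtain ⟨z, hz, rfl⟩ := hsub ⟨ha1.le.trans ht.1, ht.2.trans hb1.le⟩
    simp only [Set.mem_iUnion] at hz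
    obtain ⟨i, hi, hz⟩ := hz
    have hi' : γ i ∈ (Finset.range (n + 1)).image γ :=
      Finset.mem_image_of_mem _ (Finset.mem_range.2 (Nat.lt_succ_of_le hi))
    exact Set.mem_biUnion (Finset.mem_coe.2 hi') ⟨⟨z, hz, rfl⟩, ht⟩
  have hv := (measure_mono (μ := volume) hcov).trans (measure_biUnion_finset_le _ _)
  have hv2 := ENNReal.toReal_mono
    (ENNReal.sum_ne_top.2 fun v _ => radLen_vol_ne_top (P v) R) hv
  rw [ENNReal.toReal_sum fun v _ => radLen_vol_ne_top (P v) R, Real.volume_Icc,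
    ENNReal.toReal_ofReal (by linarith)] at hv2
  rw [← Finset.sum_div, le_div_iff₀ hR]
  change 2 * R - R ≤ ∑ v ∈ (Finset.range (n + 1)).image γ, radLen (P v) R at hv2
  linarith

/-- Radii. -/
lemma exists_radii {V : Type*} (P : V → Set ℂ) (hcompact : ∀ v, IsCompact (P v))
    (hlocfin : ∀ K : Set ℂ, IsCompact K → ({v : V | (P v ∩ K).Nonempty}).Finite) :
    ∃ R : ℕ → ℝ, (∀ k : ℕ, (k : ℝ) + 1 ≤ R k) ∧ Monotone R ∧
      ∀ k v, (P v ∩ Metric.closedBall 0 (2 * R k)).Nonempty → P v ⊆ Metric.ball 0 (R (k + 1)) := by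
  have step : ∀ r : ℝ, ∃ r' : ℝ, r + 1 ≤ r' ∧
      ∀ v, (P v ∩ Metric.closedBall 0 (2 * r)).Nonempty → P v ⊆ Metric.ball 0 r' := by
    intro r
    have hf := hlocfin _ (isCompact_closedBall (0:ℂ) (2 * r))
    have hK : IsCompact (⋃ v ∈ {v : V | (P v ∩ Metric.closedBall 0 (2 * r)).Nonempty}, P v) :=
      hf.isCompact_biUnion fun v _ => hcompact v
    obtain ⟨r', hr', hs⟩ := hK.isBounded.subset_ball_lt (r + 1) 0
    exact ⟨r', hr'.le, fun v hv z hz => hs (Set.mem_biUnion (x := v) hv hz)⟩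
  choose f hf1 hf2 using step
  refine ⟨fun k => f^[k] 1, ?_, ?_, ?_⟩
  · intro k
    induction k with
    | zero => simp
    | succ k ih =>
      simp only [Function.iterate_succ_apply'] at ih ⊢
      have := hf1 (f^[k] 1)
      push_cast
      linarith
  · refine monotone_nat_of_le_succ fun k => ?_
    rw [Function.iterate_succ_apply']
    linarith [hf1 (f^[k] 1)]
  · intro k v hv
    simp only [Function.iterate_succ_apply']
    exact hf2 _ v hv

/-- He–Schramm: a countable connected infinite planar-type graph admitting a locally finite
collection of `τ`-fat compact connected sets with bounded overlap, where adjacent vertices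
correspond to intersecting sets, is VEL-parabolic. -/
theorem velParabolic_of_fat_sets {V : Type*} [Countable V] [Infinite V]
    (G : SimpleGraph V) (hGconn : G.Connected)
    (τ : ℝ) (hτ : 0 < τ) (M : ℕ) (hM : 1 ≤ M)
    (P : V → Set ℂ)
    (hmeas : ∀ v, MeasurableSet (P v))
    (hfat : ∀ v, IsFat τ (P v))
    (hcompact : ∀ v, IsCompact (P v))
    (hconn : ∀ v, IsConnected (P v))
    (hlocfin : ∀ K : Set ℂ, IsCompact K → ({v : V | (P v ∩ K).Nonempty}).Finite)
    (hoverfin : ∀ x : ℂ, ({v : V | x ∈ P v}).Finite)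
    (hover : ∀ x : ℂ, ({v : V | x ∈ P v}).ncard ≤ M)
    (hadj : ∀ v w : V, G.Adj v w → (P v ∩ P w).Nonempty) :
    VELParabolic G := by
  classical
  obtain ⟨R, hR1, hRmono, hRsep⟩ := exists_radii P hcompact hlocfin
  have hRpos : ∀ k, 0 < R k := fun k => by
    have := hR1 k
    have : (0:ℝ) ≤ k := Nat.cast_nonneg k
    linarith
  set a : ℕ → V → ℝ := fun k v => radLen (P v) (R k) / R k / ((k : ℝ) + 1) with ha
  have ha0 : ∀ k v, 0 ≤ a k v := fun k v =>
    div_nonneg (div_nonneg (radLen_nonneg _ _) (hRpos k).le) (by positivity)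
  have hane : ∀ k v, a k v ≠ 0 → radLen (P v) (R k) ≠ 0 := by
    intro k v h h'
    apply h
    simp [ha, h']
  have hlt : ∀ j k v, j < k → a j v ≠ 0 → a k v = 0 := by
    intro j k v hjk hj
    by_contra hk
    obtain ⟨x, hx, -, hx2⟩ := radLen_exists _ _ (hane j v hj)
    obtain ⟨y, hy, hy1, -⟩ := radLen_exists _ _ (hane k v hk)
    have hs := hRsep j v ⟨x, hx, by simpa using hx2⟩
    have h1 : ‖y‖ < R (j + 1) := by simpa using hs hy
    have h2 := hRmono (Nat.succ_le_of_lt hjk)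
    have h3 : R (j + 1) ≤ R k := h2
    linarith
  have hsingle : ∀ v, ∃ k, ∀ j, j ≠ k → a j v = 0 := by
    intro v
    by_cases h : ∃ k, a k v ≠ 0
    · obtain ⟨k, hk⟩ := h
      refine ⟨k, fun j hj => ?_⟩
      rcases lt_or_gt_of_ne hj with h | h
      · by_contra hj'
        exact hk (hlt j k v h hj')
      · exact hlt k j v h hk
    · push Not at h
      exact ⟨0, fun j _ => h j⟩
  choose κ hκ using hsingle
  have hm1 : ∀ v, HasSum (fun k => a k v) (a (κ v) v) := fun v =>
    hasSum_single (κ v) (hκ v)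
  have hm2 : ∀ v, HasSum (fun k => a k v ^ 2) (a (κ v) v ^ 2) := fun v =>
    hasSum_single (κ v) fun j hj => by simp [hκ v j hj]
  refine ⟨fun v => a (κ v) v, fun v => ha0 _ _, ?_, ?_⟩
  · have hC : Summable (fun k : ℕ => 144 * M / τ * (1 / ((k : ℝ) + 1) ^ 2)) := by
      refine Summable.mul_left _ ?_
      have := (summable_nat_add_iff 1).2 (Real.summable_one_div_nat_pow.2 one_lt_two)
      simpa using this
    refine summable_of_sum_le (c := ∑' k : ℕ, 144 * M / τ * (1 / ((k : ℝ) + 1) ^ 2))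
      (fun v => sq_nonneg _) fun s => ?_
    refine hasSum_le (fun k => ?_) (hasSum_sum fun v (_ : v ∈ s) => hm2 v) hC.hasSum
    have := sum_radLen_sq_le τ hτ M P hmeas hfat hoverfin hover (R k) (hRpos k) s
    calc ∑ v ∈ s, a k v ^ 2
        = (∑ v ∈ s, (radLen (P v) (R k) / R k) ^ 2) * (1 / ((k : ℝ) + 1) ^ 2) := by
          rw [Finset.sum_mul]
          refine Finset.sum_congr rfl fun v _ => ?_
          simp only [ha]
          rw [div_pow _ ((k : ℝ) + 1)]
          ring
      _ ≤ _ := mul_le_mul_of_nonneg_right this (by positivity)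
  · intro γ hγ hinf hsum
    obtain ⟨r0, hr0⟩ := (hcompact (γ 0)).isBounded.subset_ball (0:ℂ)
    obtain ⟨k0, hk0⟩ := exists_nat_ge r0
    have hcross : ∀ k, k0 ≤ k → ∃ S : Finset V, (↑S ⊆ Set.range γ) ∧
        1 ≤ ∑ v ∈ S, radLen (P v) (R k) / R k := by
      intro k hk
      have hex : ∃ n, P (γ n) ∩ Metric.closedBall 0 (2 * R k) = ∅ := by
        by_contra hcon
        push Not at hcon
        refine hinf ((hlocfin _ (isCompact_closedBall (0:ℂ) (2 * R k))).subset ?_)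
        rintro _ ⟨n, rfl⟩
        exact hcon n
      obtain ⟨n, hn⟩ := hex
      refine ⟨(Finset.range (n + 1)).image γ, ?_, ?_⟩
      · intro v hv
        obtain ⟨i, -, rfl⟩ := Finset.mem_image.1 (Finset.mem_coe.1 hv)
        exact ⟨i, rfl⟩
      · refine crossing P hconn γ (fun i => hadj _ _ (hγ i)) (R k) (hRpos k) ?_ n hn
        refine hr0.trans (Metric.ball_subset_ball ?_)
        have : (k0 : ℝ) ≤ k := by exact_mod_cast hk
        linarith [hR1 k]
    choose S hS1 hS2 using fun k => hcross (k + k0) (Nat.le_add_left _ _)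
    have hbound : ∀ N, ∑ k ∈ Finset.range N, 1 / (((k + k0 : ℕ) : ℝ) + 1)
        ≤ ∑' v : Set.range γ, a (κ v.1) v.1 := by
      intro N
      set U : Finset V := (Finset.range N).biUnion S with hU
      have hUγ : (↑U : Set V) ⊆ Set.range γ := by
        intro v hv
        obtain ⟨k, -, hv⟩ := Finset.mem_biUnion.1 (Finset.mem_coe.1 hv)
        exact hS1 k hv
      calc _ ≤ ∑ k ∈ Finset.range N, ∑ v ∈ U, a (k + k0) v := by
            refine Finset.sum_le_sum fun k hk => ?_
            calc 1 / (((k + k0 : ℕ) : ℝ) + 1)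
                ≤ (∑ v ∈ S k, radLen (P v) (R (k + k0)) / R (k + k0))
                    / (((k + k0 : ℕ) : ℝ) + 1) :=
                  div_le_div_of_nonneg_right (hS2 k) (by positivity)
              _ = ∑ v ∈ S k, a (k + k0) v := by rw [Finset.sum_div]
              _ ≤ _ := Finset.sum_le_sum_of_subset_of_nonneg
                  (Finset.subset_biUnion_of_mem S hk) fun v _ _ => ha0 _ _
        _ = ∑ v ∈ U, ∑ k ∈ Finset.range N, a (k + k0) v := Finset.sum_comm
        _ ≤ ∑ v ∈ U, a (κ v) v := by
            refine Finset.sum_le_sum fun v _ => ?_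
            have h := sum_le_hasSum ((Finset.range N).map (addRightEmbedding k0))
              (fun k _ => ha0 k v) (hm1 v)
            rw [Finset.sum_map] at h
            exact h
        _ = ∑ v ∈ U.subtype (· ∈ Set.range γ), a (κ v.1) v.1 := by
            rw [Finset.sum_subtype_of_mem (fun v => a (κ v) v)]
            exact fun v hv => hUγ hv
        _ ≤ _ := hsum.sum_le_tsum _ fun v _ => ha0 _ _
    have hs := summable_of_sum_range_le (fun k => by positivity) hbound
    refine Real.not_summable_one_div_natCast ((summable_nat_add_iff (k0 + 1)).1 ?_)
    refine hs.congr fun k => ?_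
    push_cast
    ring
end
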